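/- Under Assumption (A), let t ≥ 1 and suppose d ∨ t ≤ γn where γ = c·(m/M ∧ m²/(L·√M))² for a small enough absolute constant c > 0. Then there is an absolute constant C such that with P_θ-probability at least 1 − e^{−t}: ‖θ̂ − θ‖ ≤ C·(√M/m)·( √(d/n) ∨ √(t/n) ). -/

import Mathlib

open MeasureTheory Real
open scoped RealInnerProductSpace BigOperators ENNReal NNReal

noncomputable section

abbrev Euc (d : ℕ) : Type := EuclideanSpace ℝ (Fin d)

/-- The noise distribution with density `e^{-V(x)}` w.r.t. Lebesgue measure. -/
def noiseMeasure {d : ℕ} (V : Euc d → ℝ) : Measure (Euc d) :=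
  MeasureTheory.volume.withDensity fun x => ENNReal.ofReal (Real.exp (-(V x)))

/-- The joint distribution of an i.i.d. sample `X_1, …, X_n` from `P_θ(dx) = e^{-V(x-θ)}dx`. -/
def sampleMeasure {d : ℕ} (V : Euc d → ℝ) (n : ℕ) (θ : Euc d) : Measure (Fin n → Euc d) :=
  Measure.pi fun _ => (noiseMeasure V).map (fun x => θ + x)

/-- `ψ_α`-norm of a random variable: `sup_{p ≥ 1} p^{-1/α} (E|η|^p)^{1/p}`. -/
def psiNorm {Ω : Type*} [MeasurableSpace Ω] (α : ℝ) (μ : Measure Ω) (η : Ω → ℝ) : ℝ :=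
  ⨆ p : {p : ℝ // 1 ≤ p}, (p : ℝ) ^ (-(1 / α)) * (∫ ω, |η ω| ^ (p : ℝ) ∂μ) ^ ((1 : ℝ) / (p : ℝ))

/-- `f` belongs to the Hölder ball of radius `B` in `C^s`, `s = l + ρ`. -/
def holderCLe {d : ℕ} (l : ℕ) (ρ : ℝ) (f : Euc d → ℝ) (B : ℝ) : Prop :=
  ContDiff ℝ l f ∧
  (∀ j : ℕ, j ≤ l → ∀ x, ‖iteratedFDeriv ℝ j f x‖ ≤ B) ∧
  (∀ x y, ‖iteratedFDeriv ℝ l f x - iteratedFDeriv ℝ l f y‖ ≤ B * ‖x - y‖ ^ ρ)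

/-- The operator `(T g)(θ) = E_θ g(θ̂)`. -/
def Texp {d : ℕ} (V : Euc d → ℝ) (n : ℕ) (hatθ : (Fin n → Euc d) → Euc d) (g : Euc d → ℝ) :
    Euc d → ℝ :=
  fun θ => ∫ x, g (hatθ x) ∂ sampleMeasure V n θ

/-- The operator `𝓑 = 𝓣 - Id`. -/
def Bop {d : ℕ} (V : Euc d → ℝ) (n : ℕ) (hatθ : (Fin n → Euc d) → Euc d) :
    (Euc d → ℝ) → Euc d → ℝ :=
  fun g θ => Texp V n hatθ g θ - g θ

/-- The bias-corrected functional `f_k = Σ_{j=0}^k (-1)^j 𝓑^j f`. -/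
def biasCorrect {d : ℕ} (V : Euc d → ℝ) (n : ℕ) (hatθ : (Fin n → Euc d) → Euc d) (k : ℕ)
    (f : Euc d → ℝ) : Euc d → ℝ :=
  fun θ => ∑ j ∈ Finset.range (k + 1), (-1 : ℝ) ^ j * (Bop V n hatθ)^[j] f θ

/-- The Poincaré constant `c(V)` of the distribution `e^{-V(x)}dx`. -/
def poincareConst {d : ℕ} (V : Euc d → ℝ) : ℝ :=
  sInf {C : ℝ | 0 ≤ C ∧ ∀ g : Euc d → ℝ, LocallyLipschitz g →
    ∫ x, (g x - ∫ y, g y ∂ noiseMeasure V) ^ 2 ∂ noiseMeasure V ≤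
      C * ∫ x, ‖gradient g x‖ ^ 2 ∂ noiseMeasure V}


section Net

variable {E : Type*} [NormedAddCommGroup E] [NormedSpace ℝ E]

/-- The closed unit ball has a `1/2`-net of cardinality at most `5 ^ finrank`. -/
theorem exists_half_net (E : Type*) [NormedAddCommGroup E] [NormedSpace ℝ E]
    [FiniteDimensional ℝ E] :
    ∃ N : Finset E, (∀ v ∈ N, ‖v‖ ≤ 1) ∧ N.card ≤ 5 ^ Module.finrank ℝ E ∧
      ∀ u : E, ‖u‖ ≤ 1 → ∃ v ∈ N, ‖u - v‖ ≤ 1 / 2 := by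
  classical
  let Sep : Finset E → Prop := fun S =>
    (∀ v ∈ S, ‖v‖ ≤ 1) ∧ ∀ v ∈ S, ∀ w ∈ S, v ≠ w → 1 / 2 ≤ ‖v - w‖
  have card_le : ∀ S, Sep S → S.card ≤ 5 ^ Module.finrank ℝ E := by
    rintro S ⟨hS, hsep⟩
    have hinj : Function.Injective fun v : E => (2 : ℝ) • v :=
      smul_right_injective E two_ne_zero
    rw [← Finset.card_image_of_injective S hinj]
    apply Besicovitch.card_le_of_separated
    · simp only [Finset.mem_image]
      rintro _ ⟨v, hv, rfl⟩
      have := hS v hv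
      rw [norm_smul, Real.norm_two]
      linarith
    · simp only [Finset.mem_image]
      rintro _ ⟨v, hv, rfl⟩ _ ⟨w, hw, rfl⟩ hvw
      have := hsep v hv w hw fun h => hvw (by rw [h])
      rw [← smul_sub, norm_smul, Real.norm_two]
      linarith
  let A : Set ℕ := {k | ∃ S, Sep S ∧ S.card = k}
  have hbdd : BddAbove A := ⟨_, by rintro _ ⟨S, hS, rfl⟩; exact card_le S hS⟩
  have hne : A.Nonempty := ⟨0, ∅, ⟨by simp, by simp⟩, by simp⟩
  obtain ⟨N, hN, hcard⟩ := Nat.sSup_mem hne hbdd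
  refine ⟨N, hN.1, card_le N hN, fun u hu => ?_⟩
  by_contra! hfar
  have hmem : u ∉ N := fun h => by
    have := hfar u h
    simp at this
    linarith
  have hins : Sep (insert u N) := by
    refine ⟨?_, ?_⟩
    · simp only [Finset.mem_insert]
      rintro v (rfl | hv)
      exacts [hu, hN.1 v hv]
    · simp only [Finset.mem_insert]
      rintro v (rfl | hv) w (rfl | hw) hvw
      · exact absurd rfl hvw
      · exact (hfar w hw).le
      · rw [norm_sub_rev]
        exact (hfar v hv).le
      · exact hN.2 v hv w hw hvw
  have := le_csSup hbdd ⟨_, hins, rfl⟩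
  rw [Finset.card_insert_of_notMem hmem] at this
  omega

/-- A linear functional bounded above on a `1/2`-net of the unit ball is bounded. -/
theorem le_two_mul_of_le_on_net {N : Finset E}
    (hN : ∀ u : E, ‖u‖ ≤ 1 → ∃ v ∈ N, ‖u - v‖ ≤ 1 / 2) (f : E →L[ℝ] ℝ) {s : ℝ}
    (hs : ∀ v ∈ N, f v ≤ s) (h : E) : f h ≤ 2 * s * ‖h‖ := by
  have unit_le : ∀ u : E, ‖u‖ ≤ 1 → f u ≤ s + ‖f‖ / 2 := by
    intro u hu
    obtain ⟨v, hv, huv⟩ := hN u hu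
    have h1 : f u = f v + f (u - v) := by rw [map_sub]; ring
    have h2 : f (u - v) ≤ ‖f‖ * ‖u - v‖ := (le_abs_self _).trans (f.le_opNorm _)
    have h3 : ‖f‖ * ‖u - v‖ ≤ ‖f‖ * (1 / 2) := by gcongr
    have := hs v hv
    linarith
  have hnonneg : 0 ≤ s + ‖f‖ / 2 := by simpa using unit_le 0 (by simp)
  have hop : ‖f‖ ≤ s + ‖f‖ / 2 := by
    refine f.opNorm_le_of_unit_norm hnonneg fun u hu => ?_
    rw [Real.norm_eq_abs, abs_le]
    have := unit_le u hu.le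
    have h' := unit_le (-u) (by simp [hu])
    rw [map_neg] at h'
    constructor <;> linarith
  calc f h ≤ ‖f‖ * ‖h‖ := (le_abs_self _).trans (f.le_opNorm _)
    _ ≤ 2 * s * ‖h‖ := by gcongr; linarith

end Net

section Taylor

variable {E : Type*} [NormedAddCommGroup E] [NormedSpace ℝ E] {V : E → ℝ} {L M : ℝ}

theorem abs_fderiv_fderiv_le (hM : ∀ x, ‖iteratedFDeriv ℝ 2 V x‖ ≤ M) (x u v : E) :
    |fderiv ℝ (fderiv ℝ V) x u v| ≤ M * (‖u‖ * ‖v‖) := by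
  have h := (iteratedFDeriv ℝ 2 V x).le_opNorm ![u, v]
  rw [iteratedFDeriv_two_apply, Fin.prod_univ_two] at h
  simp only [Matrix.cons_val_zero, Matrix.cons_val_one, Real.norm_eq_abs] at h
  exact h.trans (by gcongr; exact hM x)

theorem abs_fderiv_fderiv_sub_le
    (hL : ∀ x y, ‖iteratedFDeriv ℝ 2 V x - iteratedFDeriv ℝ 2 V y‖ ≤ L * ‖x - y‖)
    (x y u v : E) :
    |fderiv ℝ (fderiv ℝ V) x u v - fderiv ℝ (fderiv ℝ V) y u v| ≤
      L * ‖x - y‖ * (‖u‖ * ‖v‖) := by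
  have h := (iteratedFDeriv ℝ 2 V x - iteratedFDeriv ℝ 2 V y).le_opNorm ![u, v]
  rw [sub_apply, iteratedFDeriv_two_apply, iteratedFDeriv_two_apply,
    Fin.prod_univ_two] at h
  simp only [Matrix.cons_val_zero, Matrix.cons_val_one, Real.norm_eq_abs] at h
  exact h.trans (by gcongr; exact hL x y)

theorem hasDerivAt_comp_line (hV : ContDiff ℝ 2 V) (x h : E) (s : ℝ) :
    HasDerivAt (fun s : ℝ => V (x + s • h)) (fderiv ℝ V (x + s • h) h) s := by
  have hd : HasFDerivAt V (fderiv ℝ V (x + s • h)) (x + s • h) :=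
    (hV.differentiable (by norm_num) _).hasFDerivAt
  have hl : HasDerivAt (fun s : ℝ => x + s • h) h s := by
    simpa using ((hasDerivAt_id s).smul_const h).const_add x
  exact hd.comp_hasDerivAt s hl

theorem hasDerivAt_fderiv_comp_line (hV : ContDiff ℝ 2 V) (x h : E) (s : ℝ) :
    HasDerivAt (fun s : ℝ => fderiv ℝ V (x + s • h) h)
      (fderiv ℝ (fderiv ℝ V) (x + s • h) h h) s := by
  have hd : HasFDerivAt (fderiv ℝ V) (fderiv ℝ (fderiv ℝ V) (x + s • h)) (x + s • h) :=
    ((hV.fderiv_right (m := 1) (by norm_num)).differentiable (by norm_num) _).hasFDerivAt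
  have hl : HasDerivAt (fun s : ℝ => x + s • h) h s := by
    simpa using ((hasDerivAt_id s).smul_const h).const_add x
  have hc : HasDerivAt (fun s : ℝ => fderiv ℝ V (x + s • h))
      (fderiv ℝ (fderiv ℝ V) (x + s • h) h) s := hd.comp_hasDerivAt s hl
  exact (ContinuousLinearMap.apply ℝ ℝ h).hasFDerivAt.comp_hasDerivAt s hc

/-- If `q` approximates the second derivative of `V` on the segment `[x, x + h]` within `B`, then
the corresponding second-order expansion holds within `B`. -/
theorem abs_taylor_sub_le (hV : ContDiff ℝ 2 V) (x h : E) {q B : ℝ}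
    (hB : ∀ s ∈ Set.Icc (0 : ℝ) 1, |fderiv ℝ (fderiv ℝ V) (x + s • h) h h - q| ≤ B) :
    |V (x + h) - V x - fderiv ℝ V x h - q / 2| ≤ B := by
  have hB0 : 0 ≤ B := (abs_nonneg _).trans (hB 0 (by simp))
  have first : ∀ s ∈ Set.Icc (0 : ℝ) 1,
      |fderiv ℝ V (x + s • h) h - fderiv ℝ V x h - s * q| ≤ B := by
    intro s hs
    have := (convex_Icc (0 : ℝ) 1).norm_image_sub_le_of_norm_hasDerivWithin_le
      (f := fun s : ℝ => fderiv ℝ V (x + s • h) h - s * q)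
      (f' := fun s : ℝ => fderiv ℝ (fderiv ℝ V) (x + s • h) h h - q) (C := B)
      (fun s _ => ((hasDerivAt_fderiv_comp_line hV x h s).sub
        (by simpa using (hasDerivAt_id s).mul_const q)).hasDerivWithinAt)
      hB (Set.left_mem_Icc.2 zero_le_one) hs
    simp only [zero_smul, add_zero, zero_mul, sub_zero, Real.norm_eq_abs] at this
    rw [abs_of_nonneg hs.1] at this
    calc _ = |fderiv ℝ V (x + s • h) h - s * q - fderiv ℝ V x h| := by congr 1; ring
      _ ≤ B * s := this
      _ ≤ B := mul_le_of_le_one_right hB0 hs.2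
  have := norm_image_sub_le_of_norm_deriv_le_segment_01'
    (f := fun s : ℝ => V (x + s • h) - s * fderiv ℝ V x h - s ^ 2 / 2 * q)
    (f' := fun s : ℝ => fderiv ℝ V (x + s • h) h - fderiv ℝ V x h - s * q) (C := B)
    (fun s _ => (((hasDerivAt_comp_line hV x h s).sub
      (by simpa using (hasDerivAt_id s).mul_const (fderiv ℝ V x h))).sub
      ((((hasDerivAt_id s).pow 2).div_const 2).mul_const q |>.congr_deriv
        (by simp))).hasDerivWithinAt)
    (fun s hs => first s ⟨hs.1, hs.2.le⟩)
  simp only [zero_smul, add_zero, one_smul, Real.norm_eq_abs] at this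
  convert this using 2
  ring

theorem abs_taylor_one_le (hV : ContDiff ℝ 2 V) (hM : ∀ x, ‖iteratedFDeriv ℝ 2 V x‖ ≤ M)
    (x h : E) : |V (x + h) - V x - fderiv ℝ V x h| ≤ M * ‖h‖ ^ 2 := by
  have := abs_taylor_sub_le hV x h (q := 0) (B := M * ‖h‖ ^ 2) fun s _ => by
    simpa [sq] using abs_fderiv_fderiv_le hM (x + s • h) h h
  simpa using this

theorem abs_taylor_two_le (hV : ContDiff ℝ 2 V) (hL0 : 0 ≤ L)
    (hL : ∀ x y, ‖iteratedFDeriv ℝ 2 V x - iteratedFDeriv ℝ 2 V y‖ ≤ L * ‖x - y‖)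
    (x h : E) :
    |V (x + h) - V x - fderiv ℝ V x h - fderiv ℝ (fderiv ℝ V) x h h / 2| ≤ L * ‖h‖ ^ 3 := by
  refine abs_taylor_sub_le hV x h fun s hs => ?_
  refine (abs_fderiv_fderiv_sub_le hL _ _ _ _).trans ?_
  have : ‖x + s • h - x‖ ≤ ‖h‖ := by
    rw [add_sub_cancel_left, norm_smul, Real.norm_eq_abs, abs_of_nonneg hs.1]
    exact mul_le_of_le_one_left (norm_nonneg h) hs.2
  calc L * ‖x + s • h - x‖ * (‖h‖ * ‖h‖) ≤ L * ‖h‖ * (‖h‖ * ‖h‖) := by gcongr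
    _ = L * ‖h‖ ^ 3 := by ring

end Taylor

section Noise

variable {d : ℕ} {V : Euc d → ℝ} {L M : ℝ}

theorem integrable_exp_neg (h1 : ∫ x, Real.exp (-(V x)) = 1) :
    Integrable fun x => Real.exp (-(V x)) :=
  Integrable.of_integral_ne_zero (by rw [h1]; exact one_ne_zero)

theorem isProbabilityMeasure_noiseMeasure (h1 : ∫ x, Real.exp (-(V x)) = 1) :
    IsProbabilityMeasure (noiseMeasure V) := by
  refine ⟨?_⟩
  rw [noiseMeasure, withDensity_apply _ MeasurableSet.univ, Measure.restrict_univ,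
    ← ofReal_integral_eq_lintegral_ofReal (integrable_exp_neg h1)
      (Filter.Eventually.of_forall fun x => (Real.exp_pos _).le), h1, ENNReal.ofReal_one]

theorem measurable_noise_density (hV : Continuous V) :
    Measurable fun x => ENNReal.ofReal (Real.exp (-(V x))) :=
  (Real.continuous_exp.comp hV.neg).measurable.ennreal_ofReal

theorem integrable_exp_sub_translate (hV : Continuous V) (h1 : ∫ x, Real.exp (-(V x)) = 1)
    (h : Euc d) : Integrable (fun x => Real.exp (V x - V (x + h))) (noiseMeasure V) := by
  rw [noiseMeasure, integrable_withDensity_iff_integrable_smul' (measurable_noise_density hV)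
    (Filter.Eventually.of_forall fun x => ENNReal.ofReal_lt_top)]
  refine ((integrable_exp_neg h1).comp_add_right h).congr
    (Filter.Eventually.of_forall fun x => ?_)
  simp only [ENNReal.toReal_ofReal (Real.exp_pos _).le, smul_eq_mul, ← Real.exp_add]
  congr 1
  ring

theorem integral_exp_sub_translate (hV : Continuous V) (h1 : ∫ x, Real.exp (-(V x)) = 1)
    (h : Euc d) : ∫ x, Real.exp (V x - V (x + h)) ∂noiseMeasure V = 1 := by
  rw [noiseMeasure, integral_withDensity_eq_integral_toReal_smul (measurable_noise_density hV)
    (Filter.Eventually.of_forall fun x => ENNReal.ofReal_lt_top), ← h1,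
    ← integral_add_right_eq_self (fun x => Real.exp (-(V x))) h]
  congr 1 with x
  simp only [ENNReal.toReal_ofReal (Real.exp_pos _).le, smul_eq_mul, ← Real.exp_add]
  congr 1
  ring

theorem continuous_fderiv_apply (hV : ContDiff ℝ 2 V) (u : Euc d) :
    Continuous fun x => fderiv ℝ V x u :=
  (hV.continuous_fderiv (by norm_num)).clm_apply continuous_const

theorem continuous_fderiv_fderiv_apply (hV : ContDiff ℝ 2 V) (u v : Euc d) :
    Continuous fun x => fderiv ℝ (fderiv ℝ V) x u v :=
  (((hV.fderiv_right (m := 1) (by norm_num)).continuous_fderiv (by norm_num)).clm_apply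
    continuous_const).clm_apply continuous_const

theorem hasSubgaussianMGF_fderiv (hV : ContDiff ℝ 2 V) (h1 : ∫ x, Real.exp (-(V x)) = 1)
    (hM0 : 0 ≤ M) (hM : ∀ x, ‖iteratedFDeriv ℝ 2 V x‖ ≤ M) {u : Euc d} (hu : ‖u‖ ≤ 1) :
    ProbabilityTheory.HasSubgaussianMGF (fun x => fderiv ℝ V x u) ⟨2 * M, by positivity⟩
      (noiseMeasure V) := by
  have hbound : ∀ (t : ℝ) (x : Euc d), Real.exp (t * fderiv ℝ V x u) ≤
      Real.exp (M * t ^ 2) * Real.exp (V x - V (x + -(t • u))) := by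
    intro t x
    rw [← Real.exp_add, Real.exp_le_exp]
    have h2 := (abs_le.1 (abs_taylor_one_le hV hM x (-(t • u)))).2
    have h3 : ‖-(t • u)‖ ^ 2 ≤ t ^ 2 := by
      rw [norm_neg, norm_smul, mul_pow, Real.norm_eq_abs, sq_abs]
      exact mul_le_of_le_one_right (sq_nonneg t) (pow_le_one₀ (norm_nonneg u) hu)
    have h4 := mul_le_mul_of_nonneg_left h3 hM0
    simp only [map_neg, map_smul, smul_eq_mul] at h2
    linarith
  have hint : ∀ t : ℝ, Integrable (fun x => Real.exp (M * t ^ 2) *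
      Real.exp (V x - V (x + -(t • u)))) (noiseMeasure V) := fun t =>
    (integrable_exp_sub_translate hV.continuous h1 _).const_mul _
  have hexp : ∀ t : ℝ, Integrable (fun x => Real.exp (t * fderiv ℝ V x u)) (noiseMeasure V) := by
    intro t
    refine (hint t).mono' (Real.continuous_exp.comp
      (continuous_const.mul (continuous_fderiv_apply hV u))).aestronglyMeasurable
      (Filter.Eventually.of_forall fun x => ?_)
    rw [Real.norm_eq_abs, abs_of_pos (Real.exp_pos _)]
    exact hbound t x
  refine ⟨hexp, fun t => ?_⟩
  calc ∫ x, Real.exp (t * fderiv ℝ V x u) ∂noiseMeasure V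
      ≤ ∫ x, Real.exp (M * t ^ 2) * Real.exp (V x - V (x + -(t • u))) ∂noiseMeasure V :=
        integral_mono (hexp t) (hint t) (hbound t)
    _ = Real.exp (M * t ^ 2) := by
        rw [integral_const_mul, integral_exp_sub_translate hV.continuous h1, mul_one]
    _ = Real.exp (2 * M * t ^ 2 / 2) := by ring_nf

theorem two_add_sq_le_exp_add_exp_neg (a : ℝ) : 2 + a ^ 2 ≤ Real.exp a + Real.exp (-a) := by
  have h1 : Real.exp a + Real.exp (-a) = 2 + 4 * Real.sinh (|a| / 2) ^ 2 := by
    have h2 := Real.cosh_sq (|a| / 2)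
    have h3 := Real.cosh_two_mul (|a| / 2)
    rw [mul_div_cancel₀ _ (two_ne_zero' ℝ), Real.cosh_abs, Real.cosh_eq] at h3
    linarith
  have h4 : |a| / 2 ≤ Real.sinh (|a| / 2) := Real.self_le_sinh_iff.2 (by positivity)
  have h5 := pow_le_pow_left₀ (by positivity) h4 2
  rw [div_pow, sq_abs] at h5
  linarith

theorem two_sub_add_le_exp_add_exp {p q a b ρ δ : ℝ} (hp : -a - b / 2 - ρ ≤ p)
    (hq : a - b / 2 - ρ ≤ q) (hδ : b / 2 + ρ ≤ δ) :
    2 - b - 2 * ρ + (1 - δ) * a ^ 2 ≤ Real.exp p + Real.exp q := by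
  have h1 := Real.exp_le_exp.2 hp
  have h2 := Real.exp_le_exp.2 hq
  have h3 : Real.exp (-a - b / 2 - ρ) + Real.exp (a - b / 2 - ρ) =
      Real.exp (-(b / 2 + ρ)) * (Real.exp a + Real.exp (-a)) := by
    rw [mul_add, ← Real.exp_add, ← Real.exp_add, add_comm]
    ring_nf
  have h4 := two_add_sq_le_exp_add_exp_neg a
  have h5 := Real.one_sub_le_exp_neg (b / 2 + ρ)
  have h6 : (1 - (b / 2 + ρ)) * (2 + a ^ 2) ≤
      Real.exp (-(b / 2 + ρ)) * (Real.exp a + Real.exp (-a)) := by gcongr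
  nlinarith [mul_nonneg (sub_nonneg.2 hδ) (sq_nonneg a)]

theorem integrable_fderiv_fderiv [IsFiniteMeasure (noiseMeasure V)] (hV : ContDiff ℝ 2 V)
    (hM : ∀ x, ‖iteratedFDeriv ℝ 2 V x‖ ≤ M) (u v : Euc d) :
    Integrable (fun x => fderiv ℝ (fderiv ℝ V) x u v) (noiseMeasure V) :=
  Integrable.of_bound (continuous_fderiv_fderiv_apply hV u v).aestronglyMeasurable
    (M * (‖u‖ * ‖v‖)) (Filter.Eventually.of_forall fun x => abs_fderiv_fderiv_le hM x u v)

/-- The Fisher information is dominated by the expected Hessian. -/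
theorem integral_fderiv_sq_le (hV : ContDiff ℝ 2 V) (h1 : ∫ x, Real.exp (-(V x)) = 1)
    (hL0 : 0 ≤ L) (hM : ∀ x, ‖iteratedFDeriv ℝ 2 V x‖ ≤ M)
    (hL : ∀ x y, ‖iteratedFDeriv ℝ 2 V x - iteratedFDeriv ℝ 2 V y‖ ≤ L * ‖x - y‖)
    (u : Euc d) (hu : Integrable (fun x => fderiv ℝ V x u ^ 2) (noiseMeasure V)) :
    ∫ x, fderiv ℝ V x u ^ 2 ∂noiseMeasure V ≤
      ∫ x, fderiv ℝ (fderiv ℝ V) x u u ∂noiseMeasure V := by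
  have := isProbabilityMeasure_noiseMeasure h1
  set A := ∫ x, fderiv ℝ V x u ^ 2 ∂noiseMeasure V
  set B := ∫ x, fderiv ℝ (fderiv ℝ V) x u u ∂noiseMeasure V
  have hB := integrable_fderiv_fderiv hV hM u u
  let δ : ℝ → ℝ := fun s => s ^ 2 * (M * ‖u‖ ^ 2) / 2 + L * (s * ‖u‖) ^ 3
  have key : ∀ s : ℝ, 0 < s → (1 - δ s) * A ≤ B + 2 * L * s * ‖u‖ ^ 3 := by
    intro s hs
    have hle : ∀ x, 2 - s ^ 2 * fderiv ℝ (fderiv ℝ V) x u u - 2 * (L * (s * ‖u‖) ^ 3) +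
        (1 - δ s) * s ^ 2 * fderiv ℝ V x u ^ 2 ≤
          Real.exp (V x - V (x + s • u)) + Real.exp (V x - V (x + -(s • u))) := by
      intro x
      have hp := (abs_le.1 (abs_taylor_two_le hV hL0 hL x (s • u))).2
      have hq := (abs_le.1 (abs_taylor_two_le hV hL0 hL x (-(s • u)))).2
      have hn : ‖s • u‖ = s * ‖u‖ := by rw [norm_smul, Real.norm_eq_abs, abs_of_pos hs]
      simp only [map_neg, norm_neg, neg_apply, map_smul, smul_apply,
        smul_eq_mul, hn] at hp hq
      have hb := mul_le_mul_of_nonneg_left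
        (abs_le.1 (abs_fderiv_fderiv_le hM x u u)).2 (sq_nonneg s)
      have := two_sub_add_le_exp_add_exp (p := V x - V (x + s • u))
        (q := V x - V (x + -(s • u))) (a := s * fderiv ℝ V x u)
        (b := s ^ 2 * fderiv ℝ (fderiv ℝ V) x u u) (ρ := L * (s * ‖u‖) ^ 3) (δ := δ s)
        (by linarith) (by linarith) (by simp only [δ]; linarith)
      linarith
    have hi1 := integrable_exp_sub_translate hV.continuous h1 (s • u)
    have hi2 := integrable_exp_sub_translate hV.continuous h1 (-(s • u))
    have hi3 : Integrable (fun x => 2 - s ^ 2 * fderiv ℝ (fderiv ℝ V) x u u) (noiseMeasure V) :=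
      (integrable_const _).sub (hB.const_mul _)
    have hi4 : Integrable (fun x => 2 - s ^ 2 * fderiv ℝ (fderiv ℝ V) x u u -
        2 * (L * (s * ‖u‖) ^ 3)) (noiseMeasure V) := hi3.sub (integrable_const _)
    have hi5 := hu.const_mul ((1 - δ s) * s ^ 2)
    have hmono := integral_mono (hi4.add hi5) (hi1.add hi2) hle
    rw [integral_add' hi1 hi2, integral_add' hi4 hi5, integral_sub hi3 (integrable_const _),
      integral_sub (integrable_const _) (hB.const_mul _), integral_const_mul, integral_const_mul,
      integral_exp_sub_translate hV.continuous h1,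
      integral_exp_sub_translate hV.continuous h1] at hmono
    simp only [integral_const, probReal_univ, one_smul, integral_const_mul] at hmono
    change 2 - s ^ 2 * B - _ + (1 - δ s) * s ^ 2 * A ≤ _ at hmono
    refine le_of_mul_le_mul_left ?_ (pow_pos hs 2)
    linarith
  have hδ0 : Filter.Tendsto δ (nhdsWithin 0 (Set.Ioi 0)) (nhds 0) := by
    have : Continuous δ := by fun_prop
    simpa [δ] using (this.tendsto 0).mono_left nhdsWithin_le_nhds
  have hlim1 : Filter.Tendsto (fun s => (1 - δ s) * A) (nhdsWithin 0 (Set.Ioi 0)) (nhds A) := by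
    simpa using (hδ0.const_sub 1).mul_const A
  have hlim2 : Filter.Tendsto (fun s : ℝ => B + 2 * L * s * ‖u‖ ^ 3)
      (nhdsWithin 0 (Set.Ioi 0)) (nhds B) := by
    have : Continuous fun s : ℝ => B + 2 * L * s * ‖u‖ ^ 3 := by fun_prop
    simpa using (this.tendsto 0).mono_left nhdsWithin_le_nhds
  refine le_of_tendsto_of_tendsto hlim1 hlim2 ?_
  filter_upwards [self_mem_nhdsWithin] with s hs
  exact key s hs

theorem mul_norm_sq_le_integral_fderiv_fderiv {m : ℝ} (hm : 0 < m) (hV : ContDiff ℝ 2 V)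
    (h1 : ∫ x, Real.exp (-(V x)) = 1) (hL0 : 0 ≤ L)
    (hM : ∀ x, ‖iteratedFDeriv ℝ 2 V x‖ ≤ M)
    (hL : ∀ x y, ‖iteratedFDeriv ℝ 2 V x - iteratedFDeriv ℝ 2 V y‖ ≤ L * ‖x - y‖)
    {J : Euc d →L[ℝ] Euc d}
    (hJ : ∀ u, J u = ∫ x, ⟪gradient V x, u⟫ • gradient V x ∂ noiseMeasure V)
    (hJm : ∀ u : Euc d, m * ‖u‖ ^ 2 ≤ ⟪J u, u⟫) (u : Euc d) :
    m * ‖u‖ ^ 2 ≤ ∫ x, fderiv ℝ (fderiv ℝ V) x u u ∂noiseMeasure V := by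
  rcases eq_or_ne u 0 with rfl | hu
  · simp
  have hint : Integrable (fun x => ⟪gradient V x, u⟫ • gradient V x) (noiseMeasure V) := by
    by_contra hni
    have h := hJm u
    rw [hJ, integral_undef hni, inner_zero_left] at h
    have := norm_pos_iff.2 hu
    have : 0 < m * ‖u‖ ^ 2 := by positivity
    linarith
  have hgrad : ∀ x, ⟪gradient V x, u⟫ = fderiv ℝ V x u := fun x =>
    InnerProductSpace.toDual_symm_apply
  have hsq : ∀ x, ⟪u, ⟪gradient V x, u⟫ • gradient V x⟫ = fderiv ℝ V x u ^ 2 := fun x => by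
    rw [real_inner_smul_right, real_inner_comm (gradient V x) u, hgrad, sq]
  have hisq : Integrable (fun x => fderiv ℝ V x u ^ 2) (noiseMeasure V) := by
    simpa only [hsq] using hint.const_inner (𝕜 := ℝ) u
  calc m * ‖u‖ ^ 2 ≤ ⟪J u, u⟫ := hJm u
    _ = ∫ x, fderiv ℝ V x u ^ 2 ∂noiseMeasure V := by
        rw [real_inner_comm, hJ, ← integral_inner hint]
        simp only [hsq]
    _ ≤ _ := integral_fderiv_sq_le hV h1 hL0 hM hL u hisq

end Noise

section Sample

variable {d n : ℕ} {V : Euc d → ℝ} {L M : ℝ}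

theorem isProbabilityMeasure_map_translate (h1 : ∫ x, Real.exp (-(V x)) = 1) (θ : Euc d) :
    IsProbabilityMeasure ((noiseMeasure V).map fun x => θ + x) := by
  have := isProbabilityMeasure_noiseMeasure h1
  exact Measure.isProbabilityMeasure_map (measurable_const_add θ).aemeasurable

theorem isProbabilityMeasure_sampleMeasure (h1 : ∫ x, Real.exp (-(V x)) = 1) (θ : Euc d) :
    IsProbabilityMeasure (sampleMeasure V n θ) := by
  have := isProbabilityMeasure_map_translate h1 θ
  unfold sampleMeasure
  infer_instance

theorem map_sample_sub (h1 : ∫ x, Real.exp (-(V x)) = 1) (θ : Euc d) (j : Fin n) :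
    (sampleMeasure V n θ).map (fun x => x j - θ) = noiseMeasure V := by
  have := isProbabilityMeasure_map_translate h1 θ
  have h := (measurePreserving_eval
    (fun _ : Fin n => (noiseMeasure V).map fun x => θ + x) j).map_eq
  have hcomp : (fun x : Fin n → Euc d => x j - θ) = (fun y => y - θ) ∘ Function.eval j := rfl
  rw [hcomp, ← Measure.map_map (measurable_sub_const θ) (measurable_pi_apply j), sampleMeasure, h,
    Measure.map_map (measurable_sub_const θ) (measurable_const_add θ)]
  have hid : (fun y : Euc d => y - θ) ∘ (fun x => θ + x) = id := by
    ext1 x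
    simp
  rw [hid, Measure.map_id]

theorem sampleMeasure_sum_ge_le (h1 : ∫ x, Real.exp (-(V x)) = 1) (θ : Euc d) {f : Euc d → ℝ}
    (hf : Measurable f) {c : ℝ≥0} (hc : ProbabilityTheory.HasSubgaussianMGF f c (noiseMeasure V))
    {ε : ℝ} (hε : 0 ≤ ε) :
    (sampleMeasure V n θ).real {x | ε ≤ ∑ j, f (x j - θ)} ≤
      Real.exp (-(ε ^ 2 / (2 * (n * c)))) := by
  have := isProbabilityMeasure_map_translate h1 θ
  have hind : ProbabilityTheory.iIndepFun (fun (j : Fin n) (x : Fin n → Euc d) => f (x j - θ))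
      (sampleMeasure V n θ) :=
    ProbabilityTheory.iIndepFun_pi (X := fun _ y => f (y - θ))
      fun _ => (hf.comp (measurable_sub_const θ)).aemeasurable
  have hsub : ∀ j ∈ (Finset.univ : Finset (Fin n)), ProbabilityTheory.HasSubgaussianMGF
      (fun x : Fin n → Euc d => f (x j - θ)) c (sampleMeasure V n θ) := by
    intro j _
    rw [← map_sample_sub (n := n) h1 θ j] at hc
    have hmeas : Measurable fun x : Fin n → Euc d => x j - θ :=
      (measurable_sub_const θ).comp (measurable_pi_apply j)
    exact hc.of_map hmeas.aemeasurable
  have h := ProbabilityTheory.HasSubgaussianMGF.measure_sum_ge_le_of_iIndepFun hind hsub hε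
  simpa [neg_div] using h

theorem norm_fderiv_fderiv_le (hM0 : 0 ≤ M) (hM : ∀ x, ‖iteratedFDeriv ℝ 2 V x‖ ≤ M)
    (x : Euc d) : ‖fderiv ℝ (fderiv ℝ V) x‖ ≤ M :=
  ContinuousLinearMap.opNorm_le_bound₂ _ hM0 fun u v => by
    rw [mul_assoc]
    exact abs_fderiv_fderiv_le hM x u v

set_option maxSynthPendingDepth 3 in
theorem integral_fderiv_fderiv_apply [IsFiniteMeasure (noiseMeasure V)] (hV : ContDiff ℝ 2 V)
    (hM0 : 0 ≤ M) (hM : ∀ x, ‖iteratedFDeriv ℝ 2 V x‖ ≤ M) (u v : Euc d) :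
    (∫ x, fderiv ℝ (fderiv ℝ V) x ∂noiseMeasure V) u v =
      ∫ x, fderiv ℝ (fderiv ℝ V) x u v ∂noiseMeasure V := by
  have hint : Integrable (fderiv ℝ (fderiv ℝ V)) (noiseMeasure V) :=
    Integrable.of_bound ((hV.fderiv_right (m := 1) (by norm_num)).continuous_fderiv
      (by norm_num)).aestronglyMeasurable M
      (Filter.Eventually.of_forall (norm_fderiv_fderiv_le hM0 hM))
  rw [ContinuousLinearMap.integral_apply hint,
    ContinuousLinearMap.integral_apply (hint.apply_continuousLinearMap u)]

theorem sampleMeasure_gradient_ge_le (hV : ContDiff ℝ 2 V) (h1 : ∫ x, Real.exp (-(V x)) = 1)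
    (hM0 : 0 ≤ M) (hM : ∀ x, ‖iteratedFDeriv ℝ 2 V x‖ ≤ M) (θ : Euc d) {u : Euc d}
    (hu : ‖u‖ ≤ 1) {s : ℝ} (hs : 0 ≤ s) :
    (sampleMeasure V n θ).real {x | s ≤ ∑ j, fderiv ℝ V (x j - θ) u} ≤
      Real.exp (-(s ^ 2 / (2 * (n * (2 * M))))) :=
  sampleMeasure_sum_ge_le h1 θ (continuous_fderiv_apply hV u).measurable
    (hasSubgaussianMGF_fderiv hV h1 hM0 hM hu) hs

theorem sampleMeasure_hessian_ge_le (hV : ContDiff ℝ 2 V) (h1 : ∫ x, Real.exp (-(V x)) = 1)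
    (hM0 : 0 ≤ M) (hM : ∀ x, ‖iteratedFDeriv ℝ 2 V x‖ ≤ M) (θ : Euc d) {u v : Euc d}
    (hu : ‖u‖ ≤ 1) (hv : ‖v‖ ≤ 1) {s : ℝ} (hs : 0 ≤ s) :
    (sampleMeasure V n θ).real {x | s ≤ ∑ j,
      (∫ y, fderiv ℝ (fderiv ℝ V) y u v ∂noiseMeasure V -
        fderiv ℝ (fderiv ℝ V) (x j - θ) u v)} ≤
      Real.exp (-(s ^ 2 / (2 * (n * M ^ 2)))) := by
  have := isProbabilityMeasure_noiseMeasure h1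
  have hcont := continuous_fderiv_fderiv_apply hV u v
  have hmem : ∀ x, -fderiv ℝ (fderiv ℝ V) x u v ∈ Set.Icc (-M) M := by
    intro x
    have h := abs_le.1 ((abs_fderiv_fderiv_le hM x u v).trans (mul_le_of_le_one_right hM0
      (mul_le_one₀ hu (norm_nonneg v) hv)))
    constructor <;> linarith [h.1, h.2]
  have hsub := ProbabilityTheory.hasSubgaussianMGF_of_mem_Icc (μ := noiseMeasure V)
    (X := fun x => -fderiv ℝ (fderiv ℝ V) x u v) hcont.neg.measurable.aemeasurable
    (Filter.Eventually.of_forall hmem)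
  have hcoe : (((‖M - -M‖₊ / 2) ^ 2 : ℝ≥0) : ℝ) = M ^ 2 := by
    push_cast
    rw [Real.norm_eq_abs, div_pow, sq_abs]
    ring
  have h := sampleMeasure_sum_ge_le (n := n) h1 θ
    (f := fun x => -fderiv ℝ (fderiv ℝ V) x u v - ∫ y, -fderiv ℝ (fderiv ℝ V) y u v ∂noiseMeasure V)
    (hcont.neg.measurable.sub_const _) hsub hs
  rw [hcoe] at h
  simpa only [integral_neg, sub_neg_eq_add, neg_add_eq_sub] using h

end Sample

section Deterministic

variable {E : Type*} [NormedAddCommGroup E] [NormedSpace ℝ E] {V : E → ℝ} {L m r : ℝ} {n : ℕ}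

/-- A minimizer of the empirical risk lies in the ball of radius `r` as soon as the score is small
and the empirical Hessian is bounded below. -/
theorem norm_le_of_minimizer (hn : 0 < n) (hm : 0 < m) (hr : 0 < r) (hL0 : 0 ≤ L)
    (hconv : ConvexOn ℝ Set.univ V) (hV : ContDiff ℝ 2 V)
    (hL : ∀ x y, ‖iteratedFDeriv ℝ 2 V x - iteratedFDeriv ℝ 2 V y‖ ≤ L * ‖x - y‖)
    (hLr : L * r ≤ m / 16) (ξ : Fin n → E)
    (hscore : ∀ k, ∑ j, fderiv ℝ V (ξ j) k ≤ n * (m / 8 * r) * ‖k‖)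
    (hhess : ∀ k, n * (m / 2) * ‖k‖ ^ 2 ≤ ∑ j, fderiv ℝ (fderiv ℝ V) (ξ j) k k)
    {h : E} (hmin : ∑ j, V (ξ j - h) ≤ ∑ j, V (ξ j)) : ‖h‖ ≤ r := by
  by_contra! hlt
  have hh : 0 < ‖h‖ := hr.trans hlt
  have hn' : (0 : ℝ) < n := Nat.cast_pos.2 hn
  set a := r / ‖h‖ with ha
  have ha0 : 0 ≤ a := by positivity
  have ha1 : a ≤ 1 := (div_le_one hh).2 hlt.le
  have hk : ‖a • h‖ = r := by
    rw [norm_smul, Real.norm_eq_abs, abs_of_nonneg ha0, ha, div_mul_cancel₀ _ hh.ne']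
  have hle : ∑ j, V (ξ j - a • h) ≤ ∑ j, V (ξ j) := by
    have hj : ∀ j, V (ξ j - a • h) ≤ (1 - a) * V (ξ j) + a * V (ξ j - h) := by
      intro j
      have := hconv.2 (Set.mem_univ (ξ j)) (Set.mem_univ (ξ j - h)) (sub_nonneg.2 ha1) ha0
        (by ring)
      rw [show (1 - a) • ξ j + a • (ξ j - h) = ξ j - a • h by module] at this
      simpa only [smul_eq_mul] using this
    have hsum := Finset.sum_le_sum fun j (_ : j ∈ Finset.univ) => hj j
    rw [Finset.sum_add_distrib, ← Finset.mul_sum, ← Finset.mul_sum] at hsum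
    have := mul_le_mul_of_nonneg_left hmin ha0
    linarith
  have hge : ∑ j, (V (ξ j) - fderiv ℝ V (ξ j) (a • h) +
      fderiv ℝ (fderiv ℝ V) (ξ j) (a • h) (a • h) / 2 - L * r ^ 3) ≤
        ∑ j, V (ξ j - a • h) := by
    refine Finset.sum_le_sum fun j _ => ?_
    have := (abs_le.1 (abs_taylor_two_le hV hL0 hL (ξ j) (-(a • h)))).1
    rw [← sub_eq_add_neg, norm_neg, hk] at this
    simp only [map_neg, neg_apply, neg_neg] at this
    linarith
  rw [Finset.sum_sub_distrib, Finset.sum_add_distrib, Finset.sum_sub_distrib,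
    ← Finset.sum_div, Finset.sum_const, Finset.card_univ, Fintype.card_fin, nsmul_eq_mul] at hge
  have hs := hscore (a • h)
  have hH := hhess (a • h)
  rw [hk] at hs hH
  have h3 : n * (L * r ^ 3) ≤ n * (m / 16 * r ^ 2) := by
    have := mul_le_mul_of_nonneg_right hLr (sq_nonneg r)
    refine mul_le_mul_of_nonneg_left ?_ hn'.le
    linarith
  have : 0 < n * (m * r ^ 2) := by positivity
  linarith

end Deterministic

section GoodEvent

theorem five_pow_le_exp {d : ℕ} {D : ℝ} (hd : d ≤ D) : (5 : ℝ) ^ d ≤ Real.exp (2 * D) := by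
  have h5 : (5 : ℝ) ≤ Real.exp 2 := by
    have h := Real.exp_one_gt_d9
    rw [show (2 : ℝ) = 1 + 1 by norm_num, Real.exp_add]
    nlinarith
  calc (5 : ℝ) ^ d ≤ Real.exp 2 ^ d := by gcongr
    _ = Real.exp (2 * d) := by rw [← Real.exp_nat_mul, mul_comm]
    _ ≤ Real.exp (2 * D) := by gcongr

theorem union_bound_le_exp_neg {d : ℕ} {D t : ℝ} (hd : d ≤ D) (ht : 1 ≤ t) (htD : t ≤ D) :
    (5 : ℝ) ^ d * Real.exp (-(4 * D)) + 5 ^ d * (5 ^ d * Real.exp (-(6 * D))) ≤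
      Real.exp (-t) := by
  have h5 := five_pow_le_exp hd
  have h2 : (2 : ℝ) ≤ Real.exp t := by linarith [Real.add_one_le_exp t]
  have e1 : Real.exp (2 * D) * Real.exp (-(4 * D)) = Real.exp (-(2 * D)) := by
    rw [← Real.exp_add]
    ring_nf
  have e2 : Real.exp (2 * D) * (Real.exp (2 * D) * Real.exp (-(6 * D))) =
      Real.exp (-(2 * D)) := by
    rw [← Real.exp_add, ← Real.exp_add]
    ring_nf
  calc _ ≤ Real.exp (2 * D) * Real.exp (-(4 * D)) +
        Real.exp (2 * D) * (Real.exp (2 * D) * Real.exp (-(6 * D))) := by gcongr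
    _ = 2 * Real.exp (-(2 * D)) := by rw [e1, e2]; ring
    _ ≤ Real.exp t * Real.exp (-(2 * t)) := by gcongr
    _ = Real.exp (-t) := by
        rw [← Real.exp_add]
        ring_nf

/-- Outside an event of probability at most `exp (-t)`, the score is at most `2 * s` in norm and
the empirical Hessian dominates half of its expected lower bound. -/
theorem exists_bad_event {d n : ℕ} {V : Euc d → ℝ} {M m D s t : ℝ} (hn : 0 < n) (hM0 : 0 < M)
    (hm : 0 < m) (hV : ContDiff ℝ 2 V) (h1 : ∫ x, Real.exp (-(V x)) = 1)
    (hM : ∀ x, ‖iteratedFDeriv ℝ 2 V x‖ ≤ M)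
    (hfisher : ∀ u : Euc d, m * ‖u‖ ^ 2 ≤
      ∫ x, fderiv ℝ (fderiv ℝ V) x u u ∂noiseMeasure V)
    (hd : d ≤ D) (ht : 1 ≤ t) (htD : t ≤ D) (hs0 : 0 ≤ s) (hs : 16 * M * n * D ≤ s ^ 2)
    (hD : 768 * D * M ^ 2 ≤ n * m ^ 2) (θ : Euc d) :
    ∃ bad : Set (Fin n → Euc d), (sampleMeasure V n θ).real bad ≤ Real.exp (-t) ∧
      ∀ x ∉ bad, (∀ k, ∑ j, fderiv ℝ V (x j - θ) k ≤ 2 * s * ‖k‖) ∧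
        ∀ k, n * (m / 2) * ‖k‖ ^ 2 ≤ ∑ j, fderiv ℝ (fderiv ℝ V) (x j - θ) k k := by
  have := isProbabilityMeasure_noiseMeasure h1
  have := isProbabilityMeasure_sampleMeasure (n := n) h1 θ
  have hn' : (0 : ℝ) < n := Nat.cast_pos.2 hn
  obtain ⟨N, hN1, hNcard, hNnet⟩ := exists_half_net (Euc d)
  rw [finrank_euclideanSpace_fin] at hNcard
  have hNcard' : (N.card : ℝ) ≤ 5 ^ d := by exact_mod_cast hNcard
  let badG : Euc d → Set (Fin n → Euc d) := fun u => {x | s ≤ ∑ j, fderiv ℝ V (x j - θ) u}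
  let badH : Euc d → Euc d → Set (Fin n → Euc d) := fun u v => {x | n * m / 8 ≤ ∑ j,
      (∫ y, fderiv ℝ (fderiv ℝ V) y u v ∂noiseMeasure V -
        fderiv ℝ (fderiv ℝ V) (x j - θ) u v)}
  have hG : ∀ u ∈ N, (sampleMeasure V n θ).real (badG u) ≤ Real.exp (-(4 * D)) := by
    intro u hu
    refine (sampleMeasure_gradient_ge_le hV h1 hM0.le hM θ (hN1 u hu) hs0).trans ?_
    rw [Real.exp_le_exp, neg_le_neg_iff, le_div_iff₀ (by positivity)]
    linarith
  have hH : ∀ u ∈ N, ∀ v ∈ N,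
      (sampleMeasure V n θ).real (badH u v) ≤ Real.exp (-(6 * D)) := by
    intro u hu v hv
    refine (sampleMeasure_hessian_ge_le hV h1 hM0.le hM θ (hN1 u hu) (hN1 v hv)
      (by positivity)).trans ?_
    rw [Real.exp_le_exp, neg_le_neg_iff, le_div_iff₀ (by positivity)]
    have := mul_le_mul_of_nonneg_left hD hn'.le
    linarith
  refine ⟨(⋃ u ∈ N, badG u) ∪ ⋃ u ∈ N, ⋃ v ∈ N, badH u v, ?_, fun x hx => ?_⟩
  · refine le_trans ?_ (union_bound_le_exp_neg hd ht htD)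
    refine (measureReal_union_le _ _).trans (add_le_add ?_ ?_)
    · calc (sampleMeasure V n θ).real (⋃ u ∈ N, badG u)
          ≤ ∑ u ∈ N, (sampleMeasure V n θ).real (badG u) := measureReal_biUnion_finset_le _ _
        _ ≤ N.card * Real.exp (-(4 * D)) := by
            simpa using Finset.sum_le_card_nsmul N _ _ hG
        _ ≤ 5 ^ d * Real.exp (-(4 * D)) := by gcongr
    · have hu : ∀ u ∈ N, (sampleMeasure V n θ).real (⋃ v ∈ N, badH u v) ≤
          5 ^ d * Real.exp (-(6 * D)) := fun u hu =>
        calc (sampleMeasure V n θ).real (⋃ v ∈ N, badH u v)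
            ≤ ∑ v ∈ N, (sampleMeasure V n θ).real (badH u v) :=
              measureReal_biUnion_finset_le _ _
          _ ≤ N.card * Real.exp (-(6 * D)) := by
              simpa using Finset.sum_le_card_nsmul N _ _ (hH u hu)
          _ ≤ 5 ^ d * Real.exp (-(6 * D)) := by gcongr
      calc (sampleMeasure V n θ).real (⋃ u ∈ N, ⋃ v ∈ N, badH u v)
          ≤ ∑ u ∈ N, (sampleMeasure V n θ).real (⋃ v ∈ N, badH u v) :=
            measureReal_biUnion_finset_le _ _
        _ ≤ N.card * (5 ^ d * Real.exp (-(6 * D))) := by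
            simpa using Finset.sum_le_card_nsmul N _ _ hu
        _ ≤ 5 ^ d * (5 ^ d * Real.exp (-(6 * D))) := by gcongr
  · simp only [Set.mem_union, Set.mem_iUnion, not_or, not_exists, badG, badH, Set.mem_ofPred_eq,
      not_le] at hx
    obtain ⟨hxG, hxH⟩ := hx
    constructor
    · intro k
      have := le_two_mul_of_le_on_net hNnet (∑ j, fderiv ℝ V (x j - θ)) (s := s)
        (fun v hv => by simpa using (hxG v hv).le) k
      simpa using this
    · let A : Euc d →L[ℝ] Euc d →L[ℝ] ℝ :=
        ∑ j, ((∫ y, fderiv ℝ (fderiv ℝ V) y ∂noiseMeasure V) - fderiv ℝ (fderiv ℝ V) (x j - θ))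
      have hA : ∀ u v, A u v = ∑ j, (∫ y, fderiv ℝ (fderiv ℝ V) y u v ∂noiseMeasure V -
          fderiv ℝ (fderiv ℝ V) (x j - θ) u v) := fun u v => by
        simp only [A, sum_apply, sub_apply, integral_fderiv_fderiv_apply hV hM0.le hM]
      intro k
      have h2 : ∀ u ∈ N, A u k ≤ 2 * (n * m / 8) * ‖k‖ := fun u hu =>
        le_two_mul_of_le_on_net hNnet (A u) (fun v hv => by
          rw [hA]
          exact (hxH u hu v hv).le) k
      have h4 := le_two_mul_of_le_on_net hNnet (A.flip k) h2 k
      rw [ContinuousLinearMap.flip_apply, hA, Finset.sum_sub_distrib, Finset.sum_const,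
        Finset.card_univ, Fintype.card_fin, nsmul_eq_mul] at h4
      have := mul_le_mul_of_nonneg_left (hfisher k) hn'.le
      linarith

end GoodEvent

/-- Theorem 3.1 / `th_bound_on_hat_theta`: high-probability error bound
for the MLE `θ̂`. -/
theorem stmt_9 :
    ∃ c C : ℝ, 0 < c ∧ 0 < C ∧
      ∀ (L M m : ℝ),
        0 < L → 0 < M → 0 < m →
        ∀ (d n : ℕ) (V : Euc d → ℝ) (J : Euc d →L[ℝ] Euc d)
          (hatθ : (Fin n → Euc d) → Euc d),
          0 < n →
          StrictConvexOn ℝ Set.univ V →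
          ContDiff ℝ 2 V →
          (∫ x, Real.exp (-(V x)) = 1) →
          (∀ x, ‖iteratedFDeriv ℝ 2 V x‖ ≤ M) →
          (∀ x y, ‖iteratedFDeriv ℝ 2 V x - iteratedFDeriv ℝ 2 V y‖ ≤ L * ‖x - y‖) →
          (∀ u, J u = ∫ x, ⟪gradient V x, u⟫ • gradient V x ∂ noiseMeasure V) →
          (∀ u : Euc d, m * ‖u‖ ^ 2 ≤ ⟪J u, u⟫) →
          (∀ (x : Fin n → Euc d) (θ' : Euc d),
            ∑ j, V (x j - hatθ x) ≤ ∑ j, V (x j - θ')) →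
          ∀ t : ℝ, 1 ≤ t →
            max (d : ℝ) t ≤ c * (min (m / M) (m ^ 2 / (L * Real.sqrt M))) ^ 2 * n →
            ∀ θ : Euc d,
              ENNReal.ofReal (1 - Real.exp (-t)) ≤
                sampleMeasure V n θ
                  {x | ‖hatθ x - θ‖ ≤
                    C * (Real.sqrt M / m) *
                      max (Real.sqrt ((d : ℝ) / n)) (Real.sqrt (t / n))} := by
  refine ⟨1 / 2 ^ 20, 64, by norm_num, by norm_num, ?_⟩
  intro L M m hL0 hM0 hm d n V J hatθ hn hconv hV h1 hM hL hJ hJm hmin t ht hD θ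
  have hn' : (0 : ℝ) < n := Nat.cast_pos.2 hn
  have := isProbabilityMeasure_sampleMeasure (n := n) h1 θ
  have hfisher := mul_norm_sq_le_integral_fderiv_fderiv hm hV h1 hL0.le hM hL hJ hJm
  set D := max (d : ℝ) t with hDdef
  have hdD : (d : ℝ) ≤ D := le_max_left _ _
  have htD : t ≤ D := le_max_right _ _
  have hD0 : 0 < D := by linarith
  set τ := max (Real.sqrt ((d : ℝ) / n)) (Real.sqrt (t / n)) with hτdef
  have hτ : τ = Real.sqrt (D / n) := by
    rw [hτdef, ← Real.sqrt_monotone.map_max, hDdef, max_div_div_right hn'.le]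
  have hτ0 : 0 < τ := by
    rw [hτ]
    positivity
  have hτsq : τ ^ 2 * n = D := by
    rw [hτ, Real.sq_sqrt (by positivity), div_mul_cancel₀ _ hn'.ne']
  have hmin0 : 0 ≤ min (m / M) (m ^ 2 / (L * Real.sqrt M)) := by positivity
  have hD1 : 2 ^ 20 * D * M ^ 2 ≤ n * m ^ 2 := by
    have h := pow_le_pow_left₀ hmin0 (min_le_left (m / M) (m ^ 2 / (L * Real.sqrt M))) 2
    have h' : D ≤ 1 / 2 ^ 20 * (m / M) ^ 2 * n := hD.trans (by gcongr)
    calc 2 ^ 20 * D * M ^ 2 ≤ 2 ^ 20 * (1 / 2 ^ 20 * (m / M) ^ 2 * n) * M ^ 2 := by gcongr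
      _ = n * m ^ 2 := by field_simp
  have hτle : τ ≤ 1 / 2 ^ 10 * (m ^ 2 / (L * Real.sqrt M)) := by
    have h := pow_le_pow_left₀ hmin0 (min_le_right (m / M) (m ^ 2 / (L * Real.sqrt M))) 2
    have h' : D ≤ 1 / 2 ^ 20 * (m ^ 2 / (L * Real.sqrt M)) ^ 2 * n := hD.trans (by gcongr)
    rw [← hτsq] at h'
    refine le_of_sq_le_sq ?_ (by positivity)
    refine (le_of_mul_le_mul_right h' hn').trans_eq ?_
    ring
  set r := 64 * (Real.sqrt M / m) * τ with hr
  have hsM : 0 < Real.sqrt M := Real.sqrt_pos.2 hM0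
  have hr0 : 0 < r := by positivity
  have hLr : L * r ≤ m / 16 := by
    calc L * r ≤ L * (64 * (Real.sqrt M / m) * (1 / 2 ^ 10 * (m ^ 2 / (L * Real.sqrt M)))) := by
          rw [hr]
          gcongr
      _ = m / 16 := by
          field_simp
          norm_num
  have hs : 16 * M * n * D ≤ (n * (m * r / 16)) ^ 2 := by
    refine le_of_eq ?_
    rw [← hτsq, hr]
    field_simp
    rw [Real.sq_sqrt hM0.le]
    ring
  obtain ⟨bad, hbad, hgood⟩ := exists_bad_event hn hM0 hm hV h1 hM hfisher hdD ht htD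
    (by positivity) hs (by
      have : 0 ≤ D * M ^ 2 := by positivity
      linarith) θ
  have hcover : Set.univ ⊆ {x | ‖hatθ x - θ‖ ≤ r} ∪ bad := by
    intro x _
    by_cases hx : x ∈ bad
    · exact Or.inr hx
    · obtain ⟨hscore, hhess⟩ := hgood x hx
      refine Or.inl ?_
      refine norm_le_of_minimizer hn hm hr0 hL0.le hconv.convexOn hV hL hLr (fun j => x j - θ)
        (fun k => (hscore k).trans_eq (by ring)) hhess ?_
      simpa only [sub_sub_sub_cancel_right, sub_sub, add_sub_cancel] using hmin x θ
  have hone := (measureReal_mono (μ := sampleMeasure V n θ) hcover).trans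
    (measureReal_union_le _ _)
  rw [probReal_univ] at hone
  refine ENNReal.ofReal_le_of_le_toReal ?_
  change _ ≤ (sampleMeasure V n θ).real _
  linarith
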